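/- Let α = (α,…,α,α₁,…,α_r) where α appears k ≥ 1 times and α < α_i for all i, and let β = (α₁,…,α_r). Then π_α(x) ∼ π_k(x^{1/α}) · ∑_{n ∈ 𝒫_β^π} n^{-1/α} as x → ∞. -/

import Mathlib

open Filter Asymptotics Real

/-- The set of integers expressible as `p₁^{β 0} ⋯ p_r^{β (r-1)}` for primes `pᵢ`
(repetitions allowed). -/
def Psigma {r : ℕ} (β : Fin r → ℕ) : Set ℕ :=
  {n | ∃ p : Fin r → ℕ, (∀ i, (p i).Prime) ∧ n = ∏ i, p i ^ β i}

/-- The set of integers expressible as `p₁^{β 0} ⋯ p_r^{β (r-1)}` for pairwise distinct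
primes `pᵢ`. -/
def Ppi {r : ℕ} (β : Fin r → ℕ) : Set ℕ :=
  {n | ∃ p : Fin r → ℕ, (∀ i, (p i).Prime) ∧ Function.Injective p ∧ n = ∏ i, p i ^ β i}

/-- The number of `n ∈ S` with `n ≤ x`. -/
noncomputable def countIn (S : Set ℕ) (x : ℝ) : ℕ :=
  Nat.card {n : ℕ | (n : ℝ) ≤ x ∧ n ∈ S}

open MeasureTheory Topology Set in
/-- Fubini, for the Laplace transform of a bounded function against a continuous compactly
supported function and its Fourier transform. -/
theorem integral_mul_exp_mul_fourier_eq {h : ℝ → ℂ} {M : ℝ} (hm : Measurable h)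
    (hM : ∀ u, ‖h u‖ ≤ M) {φ : ℝ → ℂ} (hφ : Continuous φ) (hφs : HasCompactSupport φ)
    {ε : ℝ} (hε : 0 < ε) (y : ℝ) :
    ∫ u in Ioi (0 : ℝ), h u * Complex.exp (-(ε * u)) *
        ∫ t, φ t * Complex.exp (Complex.I * t * (y - u)) =
      ∫ t, φ t * Complex.exp (Complex.I * t * y) *
        ∫ u in Ioi (0 : ℝ), h u * Complex.exp (-((ε + Complex.I * t) * u)) := by
  have hexp : IntegrableOn (fun u : ℝ => Real.exp (-ε * u)) (Ioi 0) :=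
    exp_neg_integrableOn_Ioi 0 hε
  have hnorm (u : ℝ) : ‖Complex.exp (-(ε * u))‖ = Real.exp (-ε * u) := by
    simp [Complex.norm_exp]
  have h1 : Integrable (fun u : ℝ => h u * Complex.exp (-(ε * u)))
      (volume.restrict (Ioi (0 : ℝ))) := by
    refine (hexp.const_mul M).mono' (by fun_prop) (Eventually.of_forall fun u => ?_)
    rw [norm_mul, hnorm]
    exact mul_le_mul_of_nonneg_right (hM u) (Real.exp_pos _).le
  have h2 : Integrable φ := hφ.integrable_of_hasCompactSupport hφs
  have h3 := h1.mul_prod h2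
  simp_rw [← integral_const_mul]
  rw [integral_integral_swap]
  · refine integral_congr_ae (Eventually.of_forall fun t => ?_)
    refine integral_congr_ae (Eventually.of_forall fun u => ?_)
    simp only
    have : Complex.exp (Complex.I * t * (y - u)) * Complex.exp (-(ε * u)) =
        Complex.exp (Complex.I * t * y) * Complex.exp (-((ε + Complex.I * t) * u)) := by
      rw [← Complex.exp_add, ← Complex.exp_add]; ring_nf
    linear_combination (h u * φ t) * this
  · refine (h3.bdd_mul (c := 1) (f := fun p : ℝ × ℝ =>
      Complex.exp (Complex.I * p.2 * (y - p.1))) ?_ ?_).congr ?_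
    · fun_prop
    · refine Eventually.of_forall fun p => ?_
      have : Complex.I * p.2 * (y - p.1) = ((p.2 * (y - p.1) : ℝ) : ℂ) * Complex.I := by
        push_cast; ring
      rw [this, Complex.norm_exp_ofReal_mul_I]
    · refine Eventually.of_forall fun p => ?_
      simp only [Function.uncurry]
      ring

open MeasureTheory Topology Set in
theorem tendsto_integral_mul_fourier_of_laplace {h : ℝ → ℂ} {M : ℝ} (hm : Measurable h)
    (hM : ∀ u, ‖h u‖ ≤ M) {G : ℂ → ℂ} (hG : ContinuousOn G {z | 0 ≤ z.re})
    (hL : ∀ z : ℂ, 0 < z.re → ∫ u in Ioi (0 : ℝ), h u * Complex.exp (-(z * u)) = G z)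
    {φ : ℝ → ℂ} (hφ : Continuous φ) (hφs : HasCompactSupport φ)
    (hK : Integrable fun v : ℝ => ∫ t, φ t * Complex.exp (Complex.I * t * v)) :
    Tendsto (fun y : ℝ => ∫ u in Ioi (0 : ℝ), h u *
      ∫ t, φ t * Complex.exp (Complex.I * t * (y - u))) atTop (𝓝 0) := by
  set K : ℝ → ℂ := fun v : ℝ => ∫ t, φ t * Complex.exp (Complex.I * t * v) with hKdef
  have hGline : Continuous fun p : ℝ × ℝ => G (max p.1 0 + Complex.I * p.2) := by
    refine hG.comp_continuous (by fun_prop) fun p => ?_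
    simp
  have hKeq (y u : ℝ) : ∫ t, φ t * Complex.exp (Complex.I * t * (y - u)) = K (y - u) := by
    simp [hKdef]
  have key (y : ℝ) : ∫ u in Ioi (0 : ℝ), h u * K (y - u) =
      ∫ t, φ t * Complex.exp (Complex.I * t * y) * G (Complex.I * t) := by
    have hl : Tendsto (fun ε : ℝ => ∫ u in Ioi (0 : ℝ), h u * Complex.exp (-(ε * u)) * K (y - u))
        (𝓝[>] 0) (𝓝 (∫ u in Ioi (0 : ℝ), h u * K (y - u))) := by
      have hKi : Integrable (fun u => K (y - u)) := hK.comp_sub_left y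
      refine tendsto_integral_filter_of_dominated_convergence (fun u => M * ‖K (y - u)‖) ?_ ?_ ?_ ?_
      · refine Eventually.of_forall fun ε => ?_
        exact (by fun_prop : Measurable fun u : ℝ => h u * Complex.exp (-(ε * u)))
          |>.aestronglyMeasurable.mul hKi.aestronglyMeasurable.restrict
      · filter_upwards [self_mem_nhdsWithin] with ε (hε : 0 < ε)
        refine (ae_restrict_iff' measurableSet_Ioi).2 (Eventually.of_forall fun u (hu : 0 < u) => ?_)
        rw [norm_mul, norm_mul]
        have : ‖Complex.exp (-(ε * u))‖ ≤ 1 := by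
          simp [Complex.norm_exp]; positivity
        have h0 := hM u
        calc ‖h u‖ * ‖Complex.exp (-(ε * u))‖ * ‖K (y - u)‖ ≤ M * 1 * ‖K (y - u)‖ := by
              gcongr
              exact (norm_nonneg _).trans h0
          _ = _ := by ring
      · exact (hKi.norm.const_mul M).restrict
      · refine Eventually.of_forall fun u => ?_
        have : Tendsto (fun ε : ℝ => h u * Complex.exp (-(ε * u)) * K (y - u)) (𝓝 0)
            (𝓝 (h u * Complex.exp (-(((0 : ℝ) : ℂ) * u)) * K (y - u))) :=
          Continuous.tendsto (by fun_prop) _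
        simp only [Complex.ofReal_zero, zero_mul, neg_zero, Complex.exp_zero, mul_one] at this
        exact this.mono_left nhdsWithin_le_nhds
    have hr : Tendsto (fun ε : ℝ => ∫ t, φ t * Complex.exp (Complex.I * t * y) *
        G (max ε 0 + Complex.I * t)) (𝓝[>] 0)
        (𝓝 (∫ t, φ t * Complex.exp (Complex.I * t * y) * G (Complex.I * t))) := by
      have hcont : Continuous fun ε : ℝ => ∫ t, φ t * Complex.exp (Complex.I * t * y) *
          G (max ε 0 + Complex.I * t) := by
        refine (continuous_parametric_integral_of_continuous (μ := volume) (s := tsupport φ)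
          (f := fun ε t : ℝ => φ t * Complex.exp (Complex.I * t * y) *
            G (max ε 0 + Complex.I * t))
          (((hφ.comp continuous_snd).mul (by fun_prop : Continuous fun p : ℝ × ℝ =>
            Complex.exp (Complex.I * p.2 * y))).mul hGline) hφs).congr fun ε => ?_
        refine setIntegral_eq_integral_of_forall_compl_eq_zero fun t ht => ?_
        simp [image_eq_zero_of_notMem_tsupport ht]
      have := hcont.tendsto 0
      simp only [max_self, Complex.ofReal_zero, zero_add] at this
      exact this.mono_left nhdsWithin_le_nhds
    refine tendsto_nhds_unique hl (hr.congr' ?_)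
    filter_upwards [self_mem_nhdsWithin] with ε (hε : 0 < ε)
    have := integral_mul_exp_mul_fourier_eq hm hM hφ hφs hε y
    simp_rw [hKeq] at this
    rw [this]
    refine integral_congr_ae (Eventually.of_forall fun t => ?_)
    simp only
    rw [hL _ (by simpa using hε), max_eq_left hε.le]
  simp_rw [hKeq, key]
  have RL := Real.tendsto_integral_exp_smul_cocompact (fun t : ℝ => φ t * G (Complex.I * t))
  have hto : Tendsto (fun y : ℝ => -(y / (2 * π))) atTop (cocompact ℝ) := by
    refine Tendsto.mono_right ?_ atBot_le_cocompact
    exact tendsto_neg_atTop_atBot.comp (tendsto_id.atTop_div_const (by positivity))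
  refine (RL.comp hto).congr fun y => ?_
  simp only [Function.comp]
  refine integral_congr_ae (Eventually.of_forall fun t => ?_)
  simp only [Circle.smul_def, Real.fourierChar_apply, smul_eq_mul]
  have : ((2 * π * -(t * -(y / (2 * π))) : ℝ) : ℂ) * Complex.I = Complex.I * t * y := by
    have h2 : (2 * π * -(t * -(y / (2 * π))) : ℝ) = t * y := by field_simp
    rw [h2]; push_cast; ring
  rw [this]; ring

open MeasureTheory Topology Set in
theorem integral_one_sub_mul_two_cos (v : ℝ) :
    ∫ t in (0 : ℝ)..1, (1 - t) * (2 * cos (t * v)) = sinc (v / 2) ^ 2 := by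
  rcases eq_or_ne v 0 with rfl | hv
  · rw [intervalIntegral.integral_eq_sub_of_hasDerivAt (f := fun t => 2 * t - t ^ 2)]
    · norm_num
    · intro t _
      have h1 := ((hasDerivAt_id' t).const_mul 2).sub (hasDerivAt_pow 2 t)
      refine h1.congr_deriv ?_
      simp; ring
    · exact Continuous.intervalIntegrable (by fun_prop) _ _
  · rw [intervalIntegral.integral_eq_sub_of_hasDerivAt
      (f := fun t => 2 * ((1 - t) * sin (t * v) / v - cos (t * v) / v ^ 2))]
    · rw [sinc_of_ne_zero (by positivity)]
      have : cos v = 1 - 2 * sin (v / 2) ^ 2 := by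
        have := cos_two_mul (v / 2)
        rw [mul_div_cancel₀ _ two_ne_zero] at this
        rw [this, cos_sq']; ring
      simp only [one_mul, zero_mul, this, sin_zero, cos_zero]
      field_simp
      ring
    · intro t _
      have h0 : HasDerivAt (fun t : ℝ => t * v) v t := by
        simpa using (hasDerivAt_id' t).mul_const v
      have h1 := ((((hasDerivAt_id' t).const_sub 1).mul h0.sin).div_const v).sub
        (h0.cos.div_const (v ^ 2))
      refine (h1.const_mul 2).congr_deriv ?_
      field_simp
      ring
    · exact Continuous.intervalIntegrable (by fun_prop) _ _

open MeasureTheory Topology Set in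
/-- The Fourier transform of the triangle function is the Fejér kernel. -/
theorem integral_triangle_mul_exp (v : ℝ) :
    ∫ t : ℝ, ((max 0 (1 - |t|) : ℝ) : ℂ) * Complex.exp (Complex.I * t * v) =
      ((sinc (v / 2) ^ 2 : ℝ) : ℂ) := by
  set F : ℝ → ℂ := fun t => ((max 0 (1 - |t|) : ℝ) : ℂ) * Complex.exp (Complex.I * t * v) with hF
  have hFc : Continuous F := by fun_prop
  have hi (a b : ℝ) : IntervalIntegrable F volume a b := hFc.intervalIntegrable _ _
  have h1 : ∫ t, F t = ∫ t in (-1 : ℝ)..1, F t := by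
    rw [intervalIntegral.integral_of_le (by norm_num)]
    refine (setIntegral_eq_integral_of_forall_compl_eq_zero fun t ht => ?_).symm
    have : 1 - |t| ≤ 0 := by
      by_contra hc
      have := abs_lt.1 (by linarith : |t| < 1)
      exact ht ⟨this.1, this.2.le⟩
    simp [hF, max_eq_left this]
  have h2 : ∫ t in (-1 : ℝ)..0, F t = ∫ t in (0 : ℝ)..1, F (-t) := by
    rw [intervalIntegral.integral_comp_neg]; simp
  rw [h1, ← intervalIntegral.integral_add_adjacent_intervals (hi (-1) 0) (hi 0 1), h2,
    ← intervalIntegral.integral_add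
      (Continuous.intervalIntegrable (by fun_prop) 0 1) (hi 0 1),
    ← integral_one_sub_mul_two_cos, ← intervalIntegral.integral_ofReal]
  refine intervalIntegral.integral_congr fun t ht => ?_
  rw [uIcc_of_le zero_le_one] at ht
  have h3 : max 0 (1 - |t|) = 1 - t := by
    rw [abs_of_nonneg ht.1, max_eq_right (by linarith [ht.2])]
  simp only [hF, abs_neg, h3]
  push_cast
  rw [Complex.two_cos]
  ring_nf

open MeasureTheory Topology Set in
theorem integral_triangle_div_mul_exp {l : ℝ} (hl : 0 < l) (v : ℝ) :
    ∫ t : ℝ, ((max 0 (1 - |t / l|) : ℝ) : ℂ) * Complex.exp (Complex.I * t * v) =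
      ((l * sinc (l * v / 2) ^ 2 : ℝ) : ℂ) := by
  have := Measure.integral_comp_div (fun t : ℝ => ((max 0 (1 - |t|) : ℝ) : ℂ) *
    Complex.exp (Complex.I * t * (l * v : ℝ))) l
  rw [integral_triangle_mul_exp, abs_of_pos hl] at this
  push_cast at this ⊢
  rw [Complex.real_smul] at this
  rw [← this]
  refine integral_congr_ae (Eventually.of_forall fun t => ?_)
  have hl' : (l : ℂ) ≠ 0 := by exact_mod_cast hl.ne'
  simp only
  congr 2
  field_simp

open MeasureTheory in
theorem integrable_sinc_half_sq : Integrable fun v : ℝ => sinc (v / 2) ^ 2 := by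
  refine (integrable_inv_one_add_sq.const_mul 5).mono'
    (by have := continuous_sinc; exact Continuous.aestronglyMeasurable (by fun_prop))
    (Eventually.of_forall fun v => ?_)
  rw [norm_of_nonneg (sq_nonneg _), ← div_eq_mul_inv, le_div_iff₀ (by positivity)]
  have h1 : sinc (v / 2) ^ 2 ≤ 1 := (sq_le_one_iff_abs_le_one _).2 (abs_sinc_le_one _)
  have h2 : sinc (v / 2) ^ 2 * v ^ 2 ≤ 4 := by
    rcases eq_or_ne v 0 with rfl | hv
    · norm_num
    · rw [sinc_of_ne_zero (by positivity)]
      have := sin_sq_le_one (v / 2)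
      field_simp
      linarith
  linarith

open MeasureTheory in
theorem integral_sinc_half_sq_pos : 0 < ∫ v : ℝ, sinc (v / 2) ^ 2 := by
  have hc : Continuous fun v : ℝ => sinc (v / 2) ^ 2 := by
    have := continuous_sinc; fun_prop
  exact integral_pos_of_integrable_nonneg_nonzero (x := 0) hc integrable_sinc_half_sq
    (fun v => sq_nonneg _) (by simp)

open MeasureTheory Topology Set in
/-- A bounded nonnegative function `B` for which `B u * exp u` is monotone tends to `1` as soon as
its averages against all dilates of a nonnegative kernel do. -/
theorem tendsto_one_of_tendsto_integral_kernel {B K : ℝ → ℝ} {M : ℝ} (hB0 : ∀ u, 0 ≤ B u)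
    (hBM : ∀ u, B u ≤ M) (hmono : Monotone fun u => B u * exp u) (hK0 : ∀ v, 0 ≤ K v)
    (hKi : Integrable K) (hKpos : 0 < ∫ v, K v)
    (hlim : ∀ l : ℝ, 0 < l → Tendsto (fun y => ∫ w, B (y - w / l) * K w) atTop (𝓝 (∫ v, K v))) :
    Tendsto B atTop (𝓝 1) := by
  set c := ∫ v, K v with hc
  have hBmeas : Measurable B := by
    have h1 : Measurable fun u => B u * exp u * exp (-u) := hmono.measurable.mul (by fun_prop)
    simpa [mul_assoc, ← exp_add] using h1
  have hBle {u v d : ℝ} (huv : u ≤ v) (hd : v ≤ u + d) : B u ≤ exp d * B v := by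
    have h1 : B u * exp u ≤ B v * exp v := hmono huv
    have h2 : B u ≤ B v * exp (v - u) := by
      rw [exp_sub, ← mul_div_assoc, le_div_iff₀ (exp_pos _)]; exact h1
    calc B u ≤ B v * exp (v - u) := h2
      _ ≤ B v * exp d := mul_le_mul_of_nonneg_left (exp_le_exp.2 (by linarith)) (hB0 v)
      _ = _ := mul_comm _ _
  have hBKi (l y : ℝ) : Integrable fun w => B (y - w / l) * K w :=
    hKi.bdd_mul (c := M) (hBmeas.comp (by fun_prop)).aestronglyMeasurable
      (Eventually.of_forall fun w => by rw [norm_of_nonneg (hB0 _)]; exact hBM _)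
  set C : ℝ → ℝ := fun a => ∫ v in Icc (-a) a, K v with hC
  have hCc : ∀ a, C a ≤ c := fun a => setIntegral_le_integral hKi (Eventually.of_forall hK0)
  have hClim : Tendsto C atTop (𝓝 c) := by
    refine (intervalIntegral_tendsto_integral hKi tendsto_neg_atTop_atBot tendsto_id).congr' ?_
    filter_upwards [eventually_ge_atTop 0] with a ha
    rw [id, intervalIntegral.integral_of_le (by linarith)]
    exact integral_Icc_eq_integral_Ioc.symm
  have hwin {a w : ℝ} (ha : 0 < a) (hw : w ∈ Icc (-a) a) :
      -(1 / a) ≤ w / a ^ 2 ∧ w / a ^ 2 ≤ 1 / a := by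
    constructor
    · rw [← neg_div, div_le_div_iff₀ ha (by positivity)]; nlinarith [hw.1]
    · rw [div_le_div_iff₀ (by positivity) ha]; nlinarith [hw.2]
  have hup {a : ℝ} (ha : 0 < a) (y : ℝ) :
      B y * C a ≤ exp (2 / a) * ∫ w, B (y + 1 / a - w / a ^ 2) * K w := by
    have h1 : ∫ w in Icc (-a) a, B y * K w ≤
        ∫ w in Icc (-a) a, exp (2 / a) * (B (y + 1 / a - w / a ^ 2) * K w) := by
      refine setIntegral_mono_on (hKi.const_mul _).integrableOn
        ((hBKi _ _).const_mul _).integrableOn measurableSet_Icc fun w hw => ?_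
      obtain ⟨h2, h3⟩ := hwin ha hw
      rw [← mul_assoc]
      refine mul_le_mul_of_nonneg_right (hBle (by linarith) ?_) (hK0 w)
      have : 2 / a = 1 / a + 1 / a := by ring
      linarith
    rw [integral_const_mul, integral_const_mul] at h1
    refine h1.trans (mul_le_mul_of_nonneg_left ?_ (exp_pos _).le)
    exact setIntegral_le_integral (hBKi _ _)
      (Eventually.of_forall fun w => mul_nonneg (hB0 _) (hK0 w))
  have hlow {a : ℝ} (ha : 0 < a) (y : ℝ) :
      ∫ w, B (y - 1 / a - w / a ^ 2) * K w ≤ exp (2 / a) * B y * c + M * (c - C a) := by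
    rw [← integral_add_compl (s := Icc (-a) a) measurableSet_Icc (hBKi _ _)]
    have hcompl : ∫ w in (Icc (-a) a)ᶜ, K w = c - C a := by
      rw [hc, ← integral_add_compl (s := Icc (-a) a) measurableSet_Icc hKi, hC]; ring
    gcongr ?_ + ?_
    · calc ∫ w in Icc (-a) a, B (y - 1 / a - w / a ^ 2) * K w
          ≤ ∫ w in Icc (-a) a, exp (2 / a) * B y * K w := by
            refine setIntegral_mono_on (hBKi _ _).integrableOn (hKi.const_mul _).integrableOn
              measurableSet_Icc fun w hw => ?_
            obtain ⟨h2, h3⟩ := hwin ha hw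
            refine mul_le_mul_of_nonneg_right (hBle (by linarith) ?_) (hK0 w)
            have : 2 / a = 1 / a + 1 / a := by ring
            linarith
        _ = exp (2 / a) * B y * C a := integral_const_mul _ _
        _ ≤ _ := mul_le_mul_of_nonneg_left (hCc a) (mul_nonneg (exp_pos _).le (hB0 y))
    · rw [← hcompl, ← integral_const_mul]
      exact setIntegral_mono (hBKi _ _).integrableOn (hKi.const_mul _).integrableOn
        fun w => mul_le_mul_of_nonneg_right (hBM _) (hK0 w)
  have hexp : Tendsto (fun a : ℝ => exp (2 / a)) atTop (𝓝 1) := by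
    have := (continuous_exp.tendsto 0).comp (tendsto_const_nhds.div_atTop tendsto_id :
      Tendsto (fun a : ℝ => 2 / a) atTop (𝓝 0))
    rwa [exp_zero] at this
  refine tendsto_order.2 ⟨fun b hb => ?_, fun b hb => ?_⟩
  · have h1 : Tendsto (fun a => (c - M * (c - C a)) / (exp (2 / a) * c)) atTop (𝓝 1) := by
      have := (tendsto_const_nhds (x := c)).sub ((hClim.const_sub c).const_mul M)
        |>.div (hexp.mul_const c) (by simpa using hKpos.ne')
      simpa [Pi.div_def, hKpos.ne'] using this
    obtain ⟨a, hab, ha⟩ := ((h1.eventually_const_lt hb).and (eventually_gt_atTop 0)).exists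
    have h2 : Tendsto (fun y => ((∫ w, B (y - 1 / a - w / a ^ 2) * K w) - M * (c - C a)) /
        (exp (2 / a) * c)) atTop (𝓝 ((c - M * (c - C a)) / (exp (2 / a) * c))) := by
      have := (hlim (a ^ 2) (by positivity)).comp (tendsto_atTop_add_const_right atTop (-(1 / a))
        tendsto_id)
      exact (this.sub_const _).div_const _
    filter_upwards [h2.eventually_const_lt hab] with y hy
    refine hy.trans_le ?_
    rw [div_le_iff₀ (by positivity)]
    linarith [hlow ha y]
  · have h1 : Tendsto (fun a => exp (2 / a) * c / C a) atTop (𝓝 1) := by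
      have := (hexp.mul_const c).div hClim hKpos.ne'
      simpa [Pi.div_def, hKpos.ne'] using this
    obtain ⟨a, hab, ha, hCa⟩ := ((h1.eventually_lt_const hb).and
      ((eventually_gt_atTop 0).and (hClim.eventually_const_lt hKpos))).exists
    have h2 : Tendsto (fun y => exp (2 / a) * (∫ w, B (y + 1 / a - w / a ^ 2) * K w) / C a)
        atTop (𝓝 (exp (2 / a) * c / C a)) := by
      have := (hlim (a ^ 2) (by positivity)).comp (tendsto_atTop_add_const_right atTop (1 / a)
        tendsto_id)
      exact (this.const_mul _).div_const _
    filter_upwards [h2.eventually_lt_const hab] with y hy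
    refine lt_of_le_of_lt ?_ hy
    rw [le_div_iff₀ hCa]
    exact hup ha y

theorem vonMangoldt_residueClass_one :
    ArithmeticFunction.vonMangoldt.residueClass (1 : ZMod 1) = ArithmeticFunction.vonMangoldt := by
  funext n
  have : (n : ZMod 1) = 1 := Subsingleton.elim _ _
  simp [ArithmeticFunction.vonMangoldt.residueClass, this]

open MeasureTheory Topology Set in
theorem LSeries_vonMangoldt_eq_mul_integral_psi {s : ℂ} (hs : 1 < s.re) :
    LSeries (fun n => (ArithmeticFunction.vonMangoldt n : ℂ)) s =
      s * ∫ u in Ioi (0 : ℝ), (Chebyshev.psi (exp u) : ℂ) * Complex.exp (-(s * u)) := by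
  have hsum (n : ℕ) : ∑ k ∈ Finset.Icc 1 n, ArithmeticFunction.vonMangoldt k =
      Chebyshev.psi n := by
    simp [Chebyshev.psi, ← Finset.Icc_succ_left_eq_Ioc]
  rw [LSeries_eq_mul_integral_of_nonneg (fun n => ArithmeticFunction.vonMangoldt n)
    zero_le_one hs ?_ (fun n => ArithmeticFunction.vonMangoldt_nonneg)]
  · congr 1
    have himg : exp '' Ioi 0 = Ioi 1 := by
      ext x
      refine ⟨?_, fun hx => ⟨log x, log_pos hx, exp_log (zero_lt_one.trans hx)⟩⟩
      rintro ⟨u, hu, rfl⟩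
      exact one_lt_exp_iff.2 hu
    rw [← himg, integral_image_eq_integral_abs_deriv_smul (f := exp) (f' := exp)
      measurableSet_Ioi (fun x _ => (hasDerivAt_exp x).hasDerivWithinAt) exp_injective.injOn]
    refine setIntegral_congr_fun measurableSet_Ioi fun u _ => ?_
    rw [← Complex.ofReal_sum, hsum, ← Chebyshev.psi_eq_psi_coe_floor, abs_of_pos (exp_pos u),
      Complex.real_smul, Complex.cpow_def_of_ne_zero (by exact_mod_cast (exp_pos u).ne'),
      ← Complex.ofReal_log (exp_pos u).le, log_exp, mul_left_comm, Complex.ofReal_exp,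
      ← Complex.exp_add]
    ring_nf
  · simp_rw [hsum, rpow_one]
    refine IsBigO.of_bound (log 4 + 4) (Eventually.of_forall fun n => ?_)
    rw [norm_of_nonneg (Chebyshev.psi_nonneg _), norm_of_nonneg (Nat.cast_nonneg n)]
    exact Chebyshev.psi_le_const_mul_self (Nat.cast_nonneg n)

open MeasureTheory Topology Set in
/-- The Laplace transform of `ψ (exp u) * exp (-u) - 1` extends continuously to the closed right
half-plane. -/
theorem exists_continuousOn_laplace_psi :
    ∃ G : ℂ → ℂ, ContinuousOn G {z | 0 ≤ z.re} ∧ ∀ z : ℂ, 0 < z.re →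
      ∫ u in Ioi (0 : ℝ), ((Chebyshev.psi (exp u) * exp (-u) - 1 : ℝ) : ℂ) *
        Complex.exp (-(z * u)) = G z := by
  set A := ArithmeticFunction.vonMangoldt.LFunctionResidueClassAux (1 : ZMod 1) with hA
  have hAc : ContinuousOn A {s | 1 ≤ s.re} :=
    ArithmeticFunction.vonMangoldt.continuousOn_LFunctionResidueClassAux (1 : ZMod 1)
  refine ⟨fun z => (A (z + 1) - 1) / (z + 1), ?_, fun z hz => ?_⟩
  · refine ContinuousOn.div ?_ (by fun_prop) fun z (hz : 0 ≤ z.re) h0 => ?_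
    · refine (hAc.comp (s := {z : ℂ | 0 ≤ z.re}) (f := fun z => z + 1) (by fun_prop)
        fun z (hz : 0 ≤ z.re) => ?_).sub continuousOn_const
      simpa using hz
    · have := congrArg Complex.re h0
      simp at this; linarith
  · have hs : 1 < (z + 1).re := by simpa using hz
    have hL := LSeries_vonMangoldt_eq_mul_integral_psi hs
    have hAe := ArithmeticFunction.vonMangoldt.eqOn_LFunctionResidueClassAux
      (a := (1 : ZMod 1)) isUnit_one hs
    have hz0 : z ≠ 0 := by rintro rfl; simp at hz
    have hz1 : z + 1 ≠ 0 := by rintro h; rw [h] at hs; simp at hs; linarith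
    simp only [vonMangoldt_residueClass_one, Nat.totient_one, Nat.cast_one, inv_one,
      add_sub_cancel_right] at hAe
    change A (z + 1) = _ at hAe
    have hexp : IntegrableOn (fun u : ℝ => Complex.exp (-z * u)) (Ioi 0) :=
      integrableOn_exp_mul_complex_Ioi (by simpa using hz) 0
    have hint : ∫ u in Ioi (0 : ℝ), Complex.exp (-z * u) = 1 / z := by
      rw [integral_exp_mul_complex_Ioi (by simpa using hz)]
      simp
    have hpsi : IntegrableOn (fun u : ℝ => (Chebyshev.psi (exp u) : ℂ) *
        Complex.exp (-((z + 1) * u))) (Ioi 0) := by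
      have hmeas : Measurable Chebyshev.psi := Chebyshev.psi_mono.measurable
      refine (hexp.norm.const_mul (log 4 + 4)).mono' ?_ (Eventually.of_forall fun u => ?_)
      · exact (Complex.measurable_ofReal.comp (hmeas.comp measurable_exp)).mul
          (by fun_prop) |>.aestronglyMeasurable
      · rw [norm_mul, Complex.norm_real, norm_of_nonneg (Chebyshev.psi_nonneg _),
          Complex.norm_exp, Complex.norm_exp]
        have h1 := Chebyshev.psi_le_const_mul_self (exp_pos u).le
        have h2 : exp (-((z + 1) * u)).re = exp (-u) * exp (-z * u).re := by
          rw [← exp_add]; simp; ring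
        rw [h2, ← mul_assoc]
        refine mul_le_mul_of_nonneg_right ?_ (exp_pos _).le
        rwa [exp_neg, ← div_eq_mul_inv, div_le_iff₀ (exp_pos _)]
    have hsplit : ∫ u in Ioi (0 : ℝ), ((Chebyshev.psi (exp u) * exp (-u) - 1 : ℝ) : ℂ) *
        Complex.exp (-(z * u)) =
        ∫ u in Ioi (0 : ℝ), ((Chebyshev.psi (exp u) : ℂ) * Complex.exp (-((z + 1) * u)) -
          Complex.exp (-z * u)) := by
      refine setIntegral_congr_fun measurableSet_Ioi fun u _ => ?_
      have : Complex.exp (-((z + 1) * u)) = Complex.exp (-u) * Complex.exp (-(z * u)) := by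
        rw [← Complex.exp_add]; ring_nf
      simp only [this, neg_mul]
      push_cast
      ring
    rw [hsplit, integral_sub hpsi hexp, hint]
    simp only [hAe, hL]
    field_simp
    ring

open MeasureTheory Topology Set in
/-- The prime number theorem for `ψ`. -/
theorem tendsto_psi_exp_mul_exp_neg :
    Tendsto (fun u => Chebyshev.psi (exp u) * exp (-u)) atTop (𝓝 1) := by
  set B : ℝ → ℝ := fun u => Chebyshev.psi (exp u) * exp (-u) with hB
  have hB0 : ∀ u, 0 ≤ B u := fun u => mul_nonneg (Chebyshev.psi_nonneg _) (exp_pos _).le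
  have hBM : ∀ u, B u ≤ log 4 + 4 := fun u => by
    simp only [hB]
    rw [exp_neg, ← div_eq_mul_inv, div_le_iff₀ (exp_pos _)]
    exact Chebyshev.psi_le_const_mul_self (exp_pos u).le
  have hBneg : ∀ u ≤ 0, B u = 0 := fun u hu => by
    simp only [hB]
    rw [Chebyshev.psi_eq_zero_of_le_one (exp_le_one_iff.2 hu), zero_mul]
  have hBmeas : Measurable B :=
    (Chebyshev.psi_mono.measurable.comp measurable_exp).mul (by fun_prop)
  obtain ⟨G, hG, hL⟩ := exists_continuousOn_laplace_psi
  set K : ℝ → ℝ := fun v => sinc (v / 2) ^ 2 with hK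
  have hKi : Integrable K := integrable_sinc_half_sq
  refine tendsto_one_of_tendsto_integral_kernel hB0 hBM ?_ (fun v => sq_nonneg _) hKi
    integral_sinc_half_sq_pos fun l hl => ?_
  · have : (fun u => B u * exp u) = fun u => Chebyshev.psi (exp u) := by
      funext u; simp [hB, mul_assoc, ← exp_add]
    rw [this]
    exact Chebyshev.psi_mono.comp exp_monotone
  have hKli (y : ℝ) : Integrable fun u => l * K (l * (y - u)) :=
    ((hKi.comp_mul_left' hl.ne').comp_sub_left y).const_mul l
  have hT := tendsto_integral_mul_fourier_of_laplace (h := fun u => ((B u - 1 : ℝ) : ℂ))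
    (M := log 4 + 5) (by fun_prop) (fun u => by
      rw [Complex.norm_real, norm_eq_abs, abs_le]
      have := log_nonneg (by norm_num : (1 : ℝ) ≤ 4)
      constructor <;> linarith [hB0 u, hBM u]) hG hL
    (φ := fun t => ((max 0 (1 - |t / l|) : ℝ) : ℂ)) (by fun_prop)
    (HasCompactSupport.of_support_subset_isCompact (isCompact_Icc (a := -l) (b := l))
      fun t ht => by
        by_contra hc
        apply ht
        have : 1 ≤ |t / l| := by
          rw [abs_div, abs_of_pos hl, one_le_div hl]
          by_contra h
          have := abs_lt.1 (not_le.1 h)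
          exact hc ⟨this.1.le, this.2.le⟩
        simp [this])
    (by
      simp_rw [integral_triangle_div_mul_exp hl]
      refine Integrable.ofReal ?_
      exact (hKi.comp_mul_left' hl.ne').const_mul l)
  have hT' : Tendsto (fun y => ∫ u in Ioi (0 : ℝ), (B u - 1) * (l * K (l * (y - u)))) atTop
      (𝓝 0) := by
    have := (Complex.continuous_re.tendsto 0).comp hT
    rw [Complex.zero_re] at this
    refine this.congr fun y => ?_
    simp only [Function.comp]
    have h1 (u : ℝ) := integral_triangle_div_mul_exp hl (y - u)
    push_cast at h1
    push_cast
    simp_rw [h1]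
    rw [← Complex.ofReal_re (∫ u in Ioi (0 : ℝ), (B u - 1) * (l * K (l * (y - u)))),
      ← integral_complex_ofReal]
    simp [hK]
  have hshift (y : ℝ) : ∫ w, B (y - w / l) * K w = ∫ u in Ioi (0 : ℝ), B u * (l * K (l * (y - u))) := by
    have h1 : ∫ u in Ioi (0 : ℝ), B u * (l * K (l * (y - u))) =
        ∫ u, B u * (l * K (l * (y - u))) :=
      setIntegral_eq_integral_of_forall_compl_eq_zero fun u hu => by
        rw [hBneg u (not_lt.1 hu), zero_mul]
    rw [h1, ← integral_sub_left_eq_self (fun u => B u * (l * K (l * (y - u)))) volume y]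
    have h2 := Measure.integral_comp_div (fun v => B (y - v) * (l * K (l * (y - (y - v))))) l
    rw [abs_of_pos hl, smul_eq_mul] at h2
    have h3 : ∫ w, B (y - w / l) * (l * K (l * (y - (y - w / l)))) =
        l * ∫ w, B (y - w / l) * K w := by
      rw [← integral_const_mul]
      congr 1
      funext w
      have : l * (y - (y - w / l)) = w := by field_simp; ring
      rw [this]; ring
    rw [h3] at h2
    exact mul_left_cancel₀ hl.ne' h2
  have hone : Tendsto (fun y => ∫ u in Ioi (0 : ℝ), l * K (l * (y - u))) atTop
      (𝓝 (∫ v, K v)) := by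
    have hKl : Integrable fun v => l * K (l * v) := (hKi.comp_mul_left' hl.ne').const_mul l
    have h1 : ∫ v, l * K (l * v) = ∫ v, K v := by
      rw [integral_const_mul, Measure.integral_comp_mul_left, abs_of_pos (inv_pos.2 hl),
        smul_eq_mul, mul_inv_cancel_left₀ hl.ne']
    rw [← h1]
    refine ((aecover_Iio tendsto_id).integral_tendsto_of_countably_generated hKl).congr fun y => ?_
    rw [← integral_indicator measurableSet_Ioi, ← integral_indicator measurableSet_Iio,
      ← integral_sub_left_eq_self ((Ioi (0 : ℝ)).indicator fun u => l * K (l * (y - u))) volume y]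
    congr 1
    funext v
    simp [indicator]
  have hadd := hT'.add hone
  rw [zero_add] at hadd
  refine hadd.congr fun y => ?_
  rw [hshift, ← integral_add ?_ (hKli y).integrableOn]
  · congr 1; funext u; ring
  · refine (hKli y).restrict.bdd_mul (c := log 4 + 5) (by fun_prop) (Eventually.of_forall fun u => ?_)
    rw [norm_eq_abs, abs_le]
    have := log_nonneg (by norm_num : (1 : ℝ) ≤ 4)
    constructor <;> linarith [hB0 u, hBM u]

open Topology in
theorem tendsto_psi_div_self : Tendsto (fun x => Chebyshev.psi x / x) atTop (𝓝 1) := by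
  refine (tendsto_psi_exp_mul_exp_neg.comp tendsto_log_atTop).congr' ?_
  filter_upwards [eventually_gt_atTop 0] with x hx
  simp only [Function.comp]
  rw [exp_neg, exp_log hx, div_eq_mul_inv]

open Topology in
theorem tendsto_theta_div_self : Tendsto (fun x => Chebyshev.theta x / x) atTop (𝓝 1) := by
  have h1 : (fun x => (Chebyshev.psi - Chebyshev.theta) x / x) =O[atTop] fun x => √x / x :=
    Chebyshev.isBigO_psi_sub_theta_sqrt.mul (isBigO_refl (fun x : ℝ => x⁻¹) atTop)
  have h2 : Tendsto (fun x : ℝ => √x / x) atTop (𝓝 0) := by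
    refine tendsto_sqrt_atTop.inv_tendsto_atTop.congr fun x => ?_
    rw [Pi.inv_apply, sqrt_div_self']
    simp
  have h3 := tendsto_psi_div_self.sub (h1.trans_tendsto h2)
  rw [sub_zero] at h3
  refine h3.congr fun x => ?_
  simp only [Pi.sub_apply]
  ring

open Topology in
/-- The prime number theorem. -/
theorem tendsto_primeCounting_mul_log_div_self :
    Tendsto (fun x : ℝ => (Nat.primeCounting ⌊x⌋₊ : ℝ) * log x / x) atTop (𝓝 1) := by
  have h1 : (fun x : ℝ => ((Nat.primeCounting ⌊x⌋₊ : ℝ) - Chebyshev.theta x / log x) *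
      (log x / x)) =O[atTop] fun x => x / log x ^ 2 * (log x / x) :=
    Chebyshev.primeCounting_sub_theta_div_log_isBigO.mul (isBigO_refl _ atTop)
  have h2 : Tendsto (fun x : ℝ => x / log x ^ 2 * (log x / x)) atTop (𝓝 0) := by
    refine tendsto_log_atTop.inv_tendsto_atTop.congr' ?_
    filter_upwards [eventually_gt_atTop 1] with x hx
    have := log_pos hx
    simp only [Pi.inv_apply]
    field_simp
  have h3 := (h1.trans_tendsto h2).add tendsto_theta_div_self
  rw [zero_add] at h3
  refine h3.congr' ?_
  filter_upwards [eventually_gt_atTop 1] with x hx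
  have := log_pos hx
  field_simp
  ring

/-- `F` is asymptotically homogeneous of degree one: `F (y / c) ∼ F y / c`. -/
def IsRegularlyVaryingOne (F : ℝ → ℝ) : Prop :=
  ∀ c : ℝ, 1 ≤ c → Tendsto (fun y => F (y / c) / F y) atTop (nhds (1 / c))

open Topology in
theorem IsRegularlyVaryingOne.of_tendsto_div {F T : ℝ → ℝ} {a : ℝ} (ha : a ≠ 0)
    (hT : IsRegularlyVaryingOne T) (hT0 : ∀ᶠ y in atTop, T y ≠ 0)
    (h : Tendsto (fun y => F y / T y) atTop (𝓝 a)) : IsRegularlyVaryingOne F := by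
  intro c hc
  have hto : Tendsto (fun y : ℝ => y / c) atTop atTop :=
    tendsto_id.atTop_div_const (by linarith)
  have h1 := ((h.comp hto).mul (hT c hc)).mul (h.inv₀ ha)
  rw [mul_right_comm, mul_inv_cancel₀ ha, one_mul] at h1
  refine h1.congr' ?_
  filter_upwards [hT0, hto.eventually hT0] with y hy hy'
  simp only [Function.comp]
  field_simp

open Topology in
theorem isRegularlyVaryingOne_primeCounting :
    IsRegularlyVaryingOne fun y => (Nat.primeCounting ⌊y⌋₊ : ℝ) := by
  refine IsRegularlyVaryingOne.of_tendsto_div (T := fun x => x / log x) one_ne_zero ?_ ?_ ?_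
  · intro c hc
    have h1 : Tendsto (fun y : ℝ => log c / log y) atTop (𝓝 0) :=
      tendsto_const_nhds.div_atTop tendsto_log_atTop
    have h2 := ((tendsto_const_nhds (x := (1 : ℝ))).sub h1).inv₀ (by simp) |>.mul_const (1 / c)
    simp only [sub_zero, inv_one, one_mul] at h2
    refine h2.congr' ?_
    filter_upwards [eventually_gt_atTop 1, eventually_gt_atTop c] with y hy hyc
    have := log_pos hy
    have h3 : log (y / c) = log y - log c := log_div (by positivity) (by positivity)
    have h4 : log c < log y := log_lt_log (by positivity) hyc
    have h5 : log y - log c ≠ 0 := by linarith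
    rw [h3]
    have h6 : 1 - log c / log y = (log y - log c) / log y := by field_simp
    rw [h6]
    field_simp
  · filter_upwards [eventually_gt_atTop 1] with y hy
    have := log_pos hy
    positivity
  · refine tendsto_primeCounting_mul_log_div_self.congr fun x => ?_
    rw [div_div_eq_mul_div]

open Topology in
theorem eventually_pos_of_primeCounting_le {F : ℝ → ℝ} {C : ℝ}
    (hF0 : ∀ u, 0 ≤ F u)
    (hπ : ∀ᶠ y : ℝ in atTop, (Nat.primeCounting ⌊y⌋₊ : ℝ) ≤ C * F y) :
    ∀ᶠ y in atTop, 0 < F y := by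
  filter_upwards [hπ, eventually_ge_atTop 2] with y hy hy2
  refine (hF0 y).lt_of_ne' fun h0 => ?_
  rw [h0, mul_zero] at hy
  have h1 : 2 ≤ ⌊y⌋₊ := Nat.le_floor (by exact_mod_cast hy2)
  have h2 : Nat.primeCounting 2 ≤ Nat.primeCounting ⌊y⌋₊ := Nat.monotone_primeCounting h1
  have h3 : Nat.primeCounting 2 = 1 := by decide
  have : (1 : ℝ) ≤ Nat.primeCounting ⌊y⌋₊ := by exact_mod_cast h3 ▸ h2
  linarith

open Topology in
theorem tendsto_sum_primes_div_atTop {F : ℝ → ℝ} (hF0 : ∀ u, 0 ≤ F u)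
    (hRV : IsRegularlyVaryingOne F) (hpos : ∀ᶠ y in atTop, 0 < F y) :
    Tendsto (fun y => (∑ p ∈ Nat.primesLE ⌊y⌋₊, F (y / p)) / F y) atTop atTop := by
  refine tendsto_atTop.2 fun R => ?_
  have hdiv : Tendsto (fun n => ∑ p ∈ Nat.primesLE n, 1 / (p : ℝ)) atTop atTop := by
    have h := (not_summable_iff_tendsto_nat_atTop_of_nonneg (fun n => by
      exact Set.indicator_nonneg (fun _ _ => by positivity) n)).1 not_summable_one_div_on_primes
    refine (h.comp (tendsto_add_atTop_nat 1)).congr fun n => ?_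
    simp only [Function.comp, Nat.primesLE, Nat.primesBelow, Finset.sum_filter, Set.indicator,
      Set.mem_ofPred_eq]
  obtain ⟨n, hn⟩ := (hdiv.eventually_gt_atTop R).exists
  have hlim : Tendsto (fun y => ∑ p ∈ Nat.primesLE n, F (y / p) / F y) atTop
      (𝓝 (∑ p ∈ Nat.primesLE n, 1 / (p : ℝ))) :=
    tendsto_finsetSum _ fun p hp => hRV p
      (by exact_mod_cast (Nat.prime_of_mem_primesLE hp).one_lt.le)
  filter_upwards [hlim.eventually_const_lt hn, hpos, eventually_ge_atTop (n : ℝ)] with y hy hy0 hyn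
  refine hy.le.trans ?_
  rw [← Finset.sum_div]
  refine div_le_div_of_nonneg_right ?_ hy0.le
  refine Finset.sum_le_sum_of_subset_of_nonneg ?_ fun p _ _ => hF0 _
  exact Nat.primesLE_mono (Nat.le_floor hyn)

open Topology in
theorem IsRegularlyVaryingOne.sum_primes {F : ℝ → ℝ} {C : ℝ} (hF0 : ∀ u, 0 ≤ F u)
    (hmono : Monotone F) (hF1 : ∀ u < 1, F u = 0) (hRV : IsRegularlyVaryingOne F)
    (hπ : ∀ᶠ y : ℝ in atTop, (Nat.primeCounting ⌊y⌋₊ : ℝ) ≤ C * F y) :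
    IsRegularlyVaryingOne fun y => ∑ p ∈ Nat.primesLE ⌊y⌋₊, F (y / p) := by
  have hpos := eventually_pos_of_primeCounting_le hF0 hπ
  have hinf := tendsto_sum_primes_div_atTop hF0 hRV hpos
  set T : ℝ → ℝ := fun y => ∑ p ∈ Nat.primesLE ⌊y⌋₊, F (y / p) with hT
  have hT0 : ∀ y, 0 ≤ T y := fun y => Finset.sum_nonneg fun p _ => hF0 _
  have hTpos : ∀ᶠ y in atTop, 0 < T y := by
    filter_upwards [hinf.eventually_gt_atTop 0, hpos] with y hy hy0
    exact (div_pos_iff_of_pos_right hy0).1 hy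
  have hπT : Tendsto (fun y : ℝ => (Nat.primeCounting ⌊y⌋₊ : ℝ) / T y) atTop (𝓝 0) := by
    have h1 := hinf.inv_tendsto_atTop.const_mul C
    rw [mul_zero] at h1
    refine squeeze_zero' ?_ ?_ h1
    · exact Eventually.of_forall fun y => div_nonneg (Nat.cast_nonneg _) (hT0 y)
    · filter_upwards [hπ, hTpos] with y hy hTy
      simp only [Pi.inv_apply, inv_div, ← mul_div_assoc]
      gcongr
  intro c hc
  have hc0 : 0 < c := by linarith
  have hbound (ε : ℝ) (hε : 0 < ε) : ∃ D, ∀ u, |F (u / c) - F u / c| ≤ ε * F u + D := by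
    obtain ⟨U, hU⟩ := eventually_atTop.1 (((tendsto_order.1 (hRV c hc)).1 (1 / c - ε)
      (by linarith)).and (((tendsto_order.1 (hRV c hc)).2 (1 / c + ε) (by linarith)).and hpos))
    refine ⟨F (max U 0), fun u => ?_⟩
    rcases le_total U u with hu | hu
    · obtain ⟨h1, h2, h3⟩ := hU u hu
      rw [lt_div_iff₀ h3] at h1
      rw [div_lt_iff₀ h3] at h2
      have h4 := hF0 (max U 0)
      have h5 : F u / c = 1 / c * F u := by ring
      rw [abs_le, h5]
      constructor <;> nlinarith
    · have h1 : F (u / c) ≤ F (max U 0) := by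
        apply hmono
        rw [div_le_iff₀ hc0]
        have := le_max_left U 0
        have := le_max_right U 0
        nlinarith
      have h2 : F u / c ≤ F (max U 0) :=
        (div_le_self (hF0 u) hc).trans (hmono (hu.trans (le_max_left _ _)))
      have h3 := hF0 (u / c)
      have h4 := div_nonneg (hF0 u) hc0.le
      have h5 := mul_nonneg hε.le (hF0 u)
      rw [abs_le]
      constructor <;> linarith
  have hTc (y : ℝ) : T (y / c) = ∑ p ∈ Nat.primesLE ⌊y⌋₊, F (y / p / c) := by
    simp only [hT]
    rcases lt_or_ge y 0 with hy | hy
    · rw [Nat.floor_of_nonpos hy.le, Nat.floor_of_nonpos (div_nonpos_of_nonpos_of_nonneg hy.le hc0.le)]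
      simp [div_right_comm]
    simp only [div_right_comm]
    refine Finset.sum_subset (Nat.primesLE_mono (Nat.floor_mono (div_le_self hy hc))) ?_
    intro p hp hp'
    have hpp := Nat.prime_of_mem_primesLE hp
    apply hF1
    have h2 : ¬ p ≤ ⌊y / c⌋₊ := fun hle => hp' (Nat.mem_primesLE.2 ⟨hle, hpp⟩)
    have h3 : y / c < p := (Nat.floor_lt (by positivity)).1 (not_le.1 h2)
    have h4 : (0 : ℝ) < p := by exact_mod_cast hpp.pos
    rw [div_lt_one h4]
    exact h3
  refine Metric.tendsto_nhds.2 fun ε hε => ?_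
  obtain ⟨D, hD⟩ := hbound (ε / 2) (by positivity)
  have hsmall : Tendsto (fun y : ℝ => D * ((Nat.primeCounting ⌊y⌋₊ : ℝ) / T y)) atTop (𝓝 0) := by
    simpa using hπT.const_mul D
  filter_upwards [hTpos, hsmall.eventually_lt_const (half_pos hε)] with y hy hy2
  have h1 : |T (y / c) - T y / c| ≤ ε / 2 * T y + D * Nat.primeCounting ⌊y⌋₊ := by
    rw [hTc, hT, Finset.sum_div, ← Finset.sum_sub_distrib]
    refine (Finset.abs_sum_le_sum_abs _ _).trans ((Finset.sum_le_sum fun p _ => hD _).trans ?_)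
    rw [Finset.sum_add_distrib, ← Finset.mul_sum, Finset.sum_const,
      Nat.primesLE_card_eq_primeCounting, nsmul_eq_mul, mul_comm D]
  have h2 : T (y / c) / T y - 1 / c = (T (y / c) - T y / c) / T y := by field_simp
  rw [Real.dist_eq, h2, abs_div, abs_of_pos hy]
  calc _ ≤ (ε / 2 * T y + D * Nat.primeCounting ⌊y⌋₊) / T y := by gcongr
    _ = ε / 2 + D * ((Nat.primeCounting ⌊y⌋₊ : ℝ) / T y) := by field_simp
    _ < ε := by linarith

open Topology in
/-- A Potter bound for monotone regularly varying functions. -/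
theorem IsRegularlyVaryingOne.exists_le_mul_rpow {F : ℝ → ℝ} (hF0 : ∀ u, 0 ≤ F u)
    (hmono : Monotone F) (hF1 : ∀ u < 1, F u = 0) (hRV : IsRegularlyVaryingOne F)
    (hpos : ∀ᶠ y in atTop, 0 < F y) {θ : ℝ} (hθ0 : 0 ≤ θ) (hθ : θ < 1) :
    ∃ C Y : ℝ, ∀ y, Y ≤ y → ∀ c, 1 ≤ c → F (y / c) ≤ C * c ^ (-θ) * F y := by
  have h2θ : (1 / 2 : ℝ) < 2 ^ (-θ) := by
    rw [one_div, ← rpow_neg_one]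
    exact rpow_lt_rpow_of_exponent_lt one_lt_two (by linarith)
  obtain ⟨Y₀, hY₀⟩ := eventually_atTop.1
    (((tendsto_order.1 (hRV 2 one_le_two)).2 _ h2θ).and hpos)
  set Y := max Y₀ 1 with hYdef
  have hY1 : 1 ≤ Y := le_max_right _ _
  have hhalf (y : ℝ) (hy : Y ≤ y) : F (y / 2) ≤ 2 ^ (-θ) * F y := by
    obtain ⟨h1, h2⟩ := hY₀ y ((le_max_left _ _).trans hy)
    rw [div_lt_iff₀ h2] at h1
    exact h1.le
  have htriv (y c : ℝ) (hy : 0 ≤ y) (hc : 1 ≤ c) (hcY : c ≤ 2 * Y) :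
      F (y / c) ≤ (2 * Y) ^ θ * c ^ (-θ) * F y := by
    have h1 : F (y / c) ≤ F y := hmono (div_le_self hy hc)
    have h2 : 1 ≤ (2 * Y) ^ θ * c ^ (-θ) := by
      rw [rpow_neg (by linarith), ← div_eq_mul_inv, one_le_div (by positivity)]
      exact rpow_le_rpow (by linarith) hcY hθ0
    nlinarith [hF0 y]
  refine ⟨(2 * Y) ^ θ, Y, fun y hy c hc => ?_⟩
  obtain ⟨j, hj⟩ := pow_unbounded_of_one_lt c one_lt_two
  induction j generalizing y c with
  | zero => simp at hj; linarith
  | succ j ih =>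
    by_cases hcY : c ≤ 2 * Y
    · exact htriv y c (by linarith) hc hcY
    push Not at hcY
    by_cases hy2 : Y ≤ y / 2
    · have h1 := ih (y / 2) hy2 (c / 2) (by linarith) (by rw [pow_succ] at hj; linarith)
      have h2 : y / 2 / (c / 2) = y / c := by field_simp
      rw [h2] at h1
      have h3 : (c / 2) ^ (-θ) * 2 ^ (-θ) = c ^ (-θ) := by
        rw [← mul_rpow (by linarith) (by norm_num)]; congr 1; ring
      calc F (y / c) ≤ (2 * Y) ^ θ * (c / 2) ^ (-θ) * F (y / 2) := h1
        _ ≤ (2 * Y) ^ θ * (c / 2) ^ (-θ) * (2 ^ (-θ) * F y) := by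
            gcongr; exact hhalf y hy
        _ = (2 * Y) ^ θ * c ^ (-θ) * F y := by rw [← h3]; ring
    · push Not at hy2
      rw [hF1 (y / c) ((div_lt_one (by linarith)).2 (by linarith))]
      have := hF0 y
      have : (0 : ℝ) < c := by linarith
      positivity

/-- The squarefree integers in `[1, N]` with exactly `k` prime factors. -/
def squarefreeAlmostPrimes (k N : ℕ) : Finset ℕ :=
  (Finset.Icc 1 N).filter fun n => Squarefree n ∧ n.primeFactors.card = k

theorem mem_squarefreeAlmostPrimes {k N n : ℕ} :
    n ∈ squarefreeAlmostPrimes k N ↔ n ≤ N ∧ Squarefree n ∧ n.primeFactors.card = k := by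
  simp only [squarefreeAlmostPrimes, Finset.mem_filter, Finset.mem_Icc]
  constructor
  · rintro ⟨⟨-, h⟩, h'⟩
    exact ⟨h, h'⟩
  · rintro ⟨h, h'⟩
    exact ⟨⟨Nat.pos_of_ne_zero h'.1.ne_zero, h⟩, h'⟩

theorem squarefreeAlmostPrimes_mono (k : ℕ) : Monotone (squarefreeAlmostPrimes k) := by
  intro M N h n hn
  rw [mem_squarefreeAlmostPrimes] at hn ⊢
  exact ⟨hn.1.trans h, hn.2⟩

theorem Nat.squarefree_and_card_primeFactors_eq_one_iff {n : ℕ} :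
    (Squarefree n ∧ n.primeFactors.card = 1) ↔ n.Prime := by
  constructor
  · rintro ⟨h, h1⟩
    obtain ⟨p, hp⟩ := Finset.card_eq_one.1 h1
    have := Nat.prod_primeFactors_of_squarefree h
    rw [hp, Finset.prod_singleton] at this
    have hpp : p ∈ n.primeFactors := by simp [hp]
    exact this ▸ Nat.prime_of_mem_primeFactors hpp
  · intro h
    exact ⟨h.squarefree, by simp [h.primeFactors]⟩

theorem card_squarefreeAlmostPrimes_one (N : ℕ) :
    (squarefreeAlmostPrimes 1 N).card = Nat.primeCounting N := by
  rw [← Nat.primesLE_card_eq_primeCounting]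
  congr 1
  ext n
  rw [mem_squarefreeAlmostPrimes, Nat.squarefree_and_card_primeFactors_eq_one_iff, Nat.mem_primesLE]

theorem card_squarefreeAlmostPrimes_zero_le (N : ℕ) :
    (squarefreeAlmostPrimes 0 N).card ≤ 1 := by
  refine Finset.card_le_one.2 fun a ha b hb => ?_
  have aux (c : ℕ) (hc : c ∈ squarefreeAlmostPrimes 0 N) : c = 1 := by
    obtain ⟨-, h, h0⟩ := mem_squarefreeAlmostPrimes.1 hc
    rw [Finset.card_eq_zero, Nat.primeFactors_eq_empty] at h0
    exact h0.resolve_left h.ne_zero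
  rw [aux a ha, aux b hb]

theorem Nat.squarefree_prime_mul_iff {p t : ℕ} (hp : p.Prime) :
    Squarefree (p * t) ↔ ¬ p ∣ t ∧ Squarefree t := by
  rw [Nat.squarefree_mul_iff, hp.coprime_iff_not_dvd]
  simp [hp.squarefree]

theorem Nat.card_primeFactors_prime_mul {p t : ℕ} (hp : p.Prime) (ht : t ≠ 0) (h : ¬ p ∣ t) :
    (p * t).primeFactors.card = t.primeFactors.card + 1 := by
  rw [Nat.primeFactors_mul hp.ne_zero ht, hp.primeFactors, Finset.singleton_union,
    Finset.card_insert_of_notMem fun hm => h (Nat.dvd_of_mem_primeFactors hm)]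

theorem card_filter_dvd_squarefreeAlmostPrimes_succ (k N : ℕ) {p : ℕ} (hp : p.Prime) :
    ((squarefreeAlmostPrimes (k + 1) N).filter (p ∣ ·)).card =
      ((squarefreeAlmostPrimes k (N / p)).filter fun t => ¬ p ∣ t).card := by
  symm
  refine Finset.card_bij (fun t _ => p * t) ?_ ?_ ?_
  · intro t ht
    rw [Finset.mem_filter, mem_squarefreeAlmostPrimes] at ht ⊢
    obtain ⟨⟨h1, h2, h3⟩, h4⟩ := ht
    refine ⟨⟨?_, (Nat.squarefree_prime_mul_iff hp).2 ⟨h4, h2⟩, ?_⟩, dvd_mul_right _ _⟩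
    · rwa [mul_comm, ← Nat.le_div_iff_mul_le hp.pos]
    · rw [Nat.card_primeFactors_prime_mul hp h2.ne_zero h4, h3]
  · intro a _ b _ hab
    exact Nat.eq_of_mul_eq_mul_left hp.pos hab
  · intro s hs
    rw [Finset.mem_filter, mem_squarefreeAlmostPrimes] at hs
    obtain ⟨⟨h1, h2, h3⟩, t, rfl⟩ := hs
    obtain ⟨h4, h5⟩ := (Nat.squarefree_prime_mul_iff hp).1 h2
    rw [Nat.card_primeFactors_prime_mul hp h5.ne_zero h4] at h3
    refine ⟨t, ?_, rfl⟩
    rw [Finset.mem_filter, mem_squarefreeAlmostPrimes]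
    exact ⟨⟨(Nat.le_div_iff_mul_le hp.pos).2 (by rwa [mul_comm]), h5, by omega⟩, h4⟩

theorem sum_card_filter_dvd_squarefreeAlmostPrimes (k N : ℕ) :
    ∑ p ∈ Nat.primesLE N, ((squarefreeAlmostPrimes k N).filter (p ∣ ·)).card =
      k * (squarefreeAlmostPrimes k N).card := by
  have h := Finset.sum_card_bipartiteAbove_eq_sum_card_bipartiteBelow (s := Nat.primesLE N)
    (t := squarefreeAlmostPrimes k N) (fun p n => p ∣ n)
  simp only [Finset.bipartiteAbove, Finset.bipartiteBelow] at h
  rw [h, mul_comm, ← smul_eq_mul, ← Finset.sum_const]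
  refine Finset.sum_congr rfl fun n hn => ?_
  obtain ⟨h1, h2, h3⟩ := mem_squarefreeAlmostPrimes.1 hn
  rw [← h3]
  congr 1
  ext p
  rw [Finset.mem_filter, Nat.mem_primesLE, Nat.mem_primeFactors]
  constructor
  · rintro ⟨⟨-, h4⟩, h5⟩
    exact ⟨h4, h5, h2.ne_zero⟩
  · rintro ⟨h4, h5, -⟩
    exact ⟨⟨(Nat.le_of_dvd (Nat.pos_of_ne_zero h2.ne_zero) h5).trans h1, h4⟩, h5⟩

theorem sum_card_squarefreeAlmostPrimes_div (k N : ℕ) :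
    (k + 1) * (squarefreeAlmostPrimes (k + 1) N).card ≤
        ∑ p ∈ Nat.primesLE N, (squarefreeAlmostPrimes k (N / p)).card ∧
      ∑ p ∈ Nat.primesLE N, (squarefreeAlmostPrimes k (N / p)).card ≤
        (k + 1) * (squarefreeAlmostPrimes (k + 1) N).card +
          k * (squarefreeAlmostPrimes k N).card := by
  have key : ∑ p ∈ Nat.primesLE N, (squarefreeAlmostPrimes k (N / p)).card =
      ∑ p ∈ Nat.primesLE N, ((squarefreeAlmostPrimes k (N / p)).filter (p ∣ ·)).card +
        (k + 1) * (squarefreeAlmostPrimes (k + 1) N).card := by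
    rw [← sum_card_filter_dvd_squarefreeAlmostPrimes, ← Finset.sum_add_distrib]
    refine Finset.sum_congr rfl fun p hp => ?_
    rw [card_filter_dvd_squarefreeAlmostPrimes_succ k N (Nat.mem_primesLE.1 hp).2,
      Finset.card_filter_add_card_filter_not]
  have hle : ∑ p ∈ Nat.primesLE N, ((squarefreeAlmostPrimes k (N / p)).filter (p ∣ ·)).card ≤
      k * (squarefreeAlmostPrimes k N).card := by
    rw [← sum_card_filter_dvd_squarefreeAlmostPrimes]
    exact Finset.sum_le_sum fun p _ => Finset.card_le_card
      (Finset.filter_subset_filter _ (squarefreeAlmostPrimes_mono k (Nat.div_le_self N p)))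
  omega

/-- The number of squarefree integers in `[1, y]` with exactly `k` prime factors. -/
noncomputable def squarefreeAlmostPrimeCount (k : ℕ) (y : ℝ) : ℝ :=
  (squarefreeAlmostPrimes k ⌊y⌋₊).card

theorem squarefreeAlmostPrimeCount_nonneg (k : ℕ) (y : ℝ) : 0 ≤ squarefreeAlmostPrimeCount k y :=
  Nat.cast_nonneg _

theorem squarefreeAlmostPrimeCount_mono (k : ℕ) : Monotone (squarefreeAlmostPrimeCount k) := by
  intro a b hab
  exact Nat.cast_le.2 (Finset.card_le_card (squarefreeAlmostPrimes_mono k (Nat.floor_mono hab)))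

theorem squarefreeAlmostPrimeCount_of_lt_one (k : ℕ) (u : ℝ) (hu : u < 1) :
    squarefreeAlmostPrimeCount k u = 0 := by
  simp [squarefreeAlmostPrimeCount, squarefreeAlmostPrimes, Nat.floor_eq_zero.2 hu]

theorem squarefreeAlmostPrimeCount_one :
    squarefreeAlmostPrimeCount 1 = fun y => (Nat.primeCounting ⌊y⌋₊ : ℝ) := by
  ext y
  rw [squarefreeAlmostPrimeCount, card_squarefreeAlmostPrimes_one]

open Topology in
/-- Regular variation of the count of squarefree integers with `k + 1` prime factors, with the
comparisons to neighbouring counts that drive the induction. -/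
theorem squarefreeAlmostPrimeCount_asymptotics (k : ℕ) :
    IsRegularlyVaryingOne (squarefreeAlmostPrimeCount (k + 1)) ∧
      (∃ C : ℝ, ∀ᶠ y : ℝ in atTop,
        (Nat.primeCounting ⌊y⌋₊ : ℝ) ≤ C * squarefreeAlmostPrimeCount (k + 1) y) ∧
      Tendsto (fun y => squarefreeAlmostPrimeCount k y / squarefreeAlmostPrimeCount (k + 1) y)
        atTop (𝓝 0) := by
  induction k with
  | zero =>
    rw [zero_add, squarefreeAlmostPrimeCount_one]
    refine ⟨isRegularlyVaryingOne_primeCounting, ⟨1, by simp⟩, ?_⟩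
    have h1 : Tendsto (fun y : ℝ => 1 / (Nat.primeCounting ⌊y⌋₊ : ℝ)) atTop (𝓝 0) :=
      tendsto_const_nhds.div_atTop (tendsto_natCast_atTop_atTop.comp
        (Nat.tendsto_primeCounting.comp tendsto_nat_floor_atTop))
    refine squeeze_zero (fun y => by
      have := squarefreeAlmostPrimeCount_nonneg 0 y
      positivity) (fun y => ?_) h1
    gcongr
    rw [squarefreeAlmostPrimeCount]
    exact_mod_cast card_squarefreeAlmostPrimes_zero_le _
  | succ k ih =>
    obtain ⟨hRV, ⟨C, hC⟩, -⟩ := ih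
    set F := squarefreeAlmostPrimeCount (k + 1) with hF
    set G := squarefreeAlmostPrimeCount (k + 2) with hG
    have hF0 := squarefreeAlmostPrimeCount_nonneg (k + 1)
    have hpos := eventually_pos_of_primeCounting_le hF0 hC
    have hinf := tendsto_sum_primes_div_atTop hF0 hRV hpos
    have hTRV := hRV.sum_primes hF0 (squarefreeAlmostPrimeCount_mono _)
      (squarefreeAlmostPrimeCount_of_lt_one _) hC
    set T : ℝ → ℝ := fun y => ∑ p ∈ Nat.primesLE ⌊y⌋₊, F (y / p) with hT
    have hrec (y : ℝ) : (k + 2) * G y ≤ T y ∧ T y ≤ (k + 2) * G y + (k + 1) * F y := by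
      have h := sum_card_squarefreeAlmostPrimes_div (k + 1) ⌊y⌋₊
      have hTy : T y = ((∑ p ∈ Nat.primesLE ⌊y⌋₊,
          (squarefreeAlmostPrimes (k + 1) (⌊y⌋₊ / p)).card : ℕ) : ℝ) := by
        push_cast
        refine Finset.sum_congr rfl fun p _ => ?_
        rw [hF, squarefreeAlmostPrimeCount, Nat.floor_div_natCast]
      have h1 := (Nat.cast_le (α := ℝ)).2 h.1
      have h2 := (Nat.cast_le (α := ℝ)).2 h.2
      rw [← hTy] at h1 h2
      push_cast at h1 h2
      rw [hG, hF]
      simp only [squarefreeAlmostPrimeCount]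
      constructor <;> linarith
    have hTpos : ∀ᶠ y in atTop, 0 < T y := by
      filter_upwards [hinf.eventually_gt_atTop 0, hpos] with y hy hy0
      exact (div_pos_iff_of_pos_right hy0).1 hy
    have hFT : Tendsto (fun y => F y / T y) atTop (𝓝 0) := by
      refine hinf.inv_tendsto_atTop.congr fun y => ?_
      rw [Pi.inv_apply, inv_div]
    have hk : (0 : ℝ) < k + 2 := by positivity
    have hGT : Tendsto (fun y => G y / T y) atTop (𝓝 (1 / (k + 2))) := by
      have hlow : Tendsto (fun y => (1 - (k + 1) * (F y / T y)) / (k + 2)) atTop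
          (𝓝 (1 / (k + 2))) := by
        simpa using ((hFT.const_mul ((k : ℝ) + 1)).const_sub 1).div_const ((k : ℝ) + 2)
      refine tendsto_of_tendsto_of_tendsto_of_le_of_le' hlow tendsto_const_nhds ?_ ?_
      · filter_upwards [hTpos] with y hy
        rw [div_le_div_iff₀ hk hy, sub_mul, mul_assoc, div_mul_cancel₀ _ hy.ne']
        linarith [(hrec y).2]
      · filter_upwards [hTpos] with y hy
        rw [div_le_div_iff₀ hy hk]
        linarith [(hrec y).1]
    have hGRV := IsRegularlyVaryingOne.of_tendsto_div (by positivity) hTRV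
      (hTpos.mono fun _ h => h.ne') hGT
    have hGpos : ∀ᶠ y in atTop, 0 < G y := by
      filter_upwards [(tendsto_order.1 hGT).1 0 (by positivity), hTpos] with y hy hy0
      exact (div_pos_iff_of_pos_right hy0).1 hy
    have hFG : Tendsto (fun y => F y / G y) atTop (𝓝 0) := by
      have := hFT.div hGT (by positivity)
      rw [zero_div] at this
      refine this.congr' ?_
      filter_upwards [hTpos] with y hy
      simp only [Pi.div_apply]
      rw [div_div_div_cancel_right₀ hy.ne']
    refine ⟨hGRV, ⟨|C|, ?_⟩, hFG⟩
    filter_upwards [hC, hGpos, (tendsto_order.1 hFG).2 1 one_pos] with y h1 h2 h3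
    rw [div_lt_one h2] at h3
    exact h1.trans (mul_le_mul (le_abs_self C) h3.le (hF0 y) (abs_nonneg C))

theorem pos_of_mem_Ppi {r n : ℕ} {β : Fin r → ℕ} (hn : n ∈ Ppi β) : 0 < n := by
  obtain ⟨p, hp, -, rfl⟩ := hn
  exact Finset.prod_pos fun i _ => pow_pos (hp i).pos _

theorem mem_Ppi_one_iff {k n : ℕ} :
    n ∈ Ppi (fun _ : Fin k => 1) ↔ Squarefree n ∧ n.primeFactors.card = k := by
  constructor
  · rintro ⟨p, hp, hinj, rfl⟩
    have hprod : ∏ i, p i ^ 1 = ∏ q ∈ Finset.univ.image p, q := by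
      rw [Finset.prod_image fun a _ b _ h => hinj h]
      simp
    have hprime (q) (hq : q ∈ Finset.univ.image p) : q.Prime := by
      obtain ⟨i, -, rfl⟩ := Finset.mem_image.1 hq
      exact hp i
    rw [hprod, Nat.primeFactors_prod hprime, Finset.card_image_of_injective _ hinj]
    refine ⟨Finset.squarefree_prod_of_pairwise_isCoprime ?_ fun q hq => (hprime q hq).squarefree,
      by simp⟩
    intro a ha b hb hab
    simp only [Function.onFun]
    rw [← Nat.coprime_iff_isRelPrime, Nat.coprime_primes (hprime a ha) (hprime b hb)]
    exact hab
  · rintro ⟨hn, hk⟩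
    refine ⟨n.primeFactors.orderEmbOfFin hk,
      fun i => Nat.prime_of_mem_primeFactors (Finset.orderEmbOfFin_mem _ hk i),
      (n.primeFactors.orderEmbOfFin hk).injective, ?_⟩
    conv_lhs => rw [← Nat.prod_primeFactors_of_squarefree hn,
      ← Finset.image_orderEmbOfFin_univ _ hk]
    rw [Finset.prod_image fun a _ b _ h => (n.primeFactors.orderEmbOfFin hk).injective h]
    simp

theorem mem_Ppi_append_iff {k r α n : ℕ} {β : Fin r → ℕ} (hβ : ∀ i, β i ≠ 0) :
    n ∈ Ppi (Fin.append (fun _ : Fin k => α) β) ↔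
      ∃ m ∈ Ppi β, ∃ s ∈ Ppi (fun _ : Fin k => 1), Nat.Coprime s m ∧ n = s ^ α * m := by
  constructor
  · rintro ⟨p, hp, hinj, rfl⟩
    refine ⟨_, ⟨fun i => p (Fin.natAdd k i), fun i => hp _,
      hinj.comp (Fin.natAdd_injective _ _), rfl⟩, _,
      ⟨fun i => p (Fin.castAdd r i), fun i => hp _, hinj.comp (Fin.castAdd_injective _ _), rfl⟩,
      ?_, ?_⟩
    · refine Nat.Coprime.prod_left fun i _ => Nat.Coprime.prod_right fun j _ => ?_
      refine Nat.Coprime.pow _ _ ((Nat.coprime_primes (hp _) (hp _)).2 fun h => ?_)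
      have := congrArg Fin.val (hinj h)
      simp only [Fin.val_castAdd, Fin.val_natAdd] at this
      omega
    · simp [Fin.prod_univ_add, Finset.prod_pow]
  · rintro ⟨_, ⟨q, hq, hqinj, rfl⟩, _, ⟨p, hp, hpinj, rfl⟩, hcop, rfl⟩
    refine ⟨Fin.append p q, fun i => ?_, Fin.append_injective_iff.2 ⟨hpinj, hqinj, ?_⟩, ?_⟩
    · refine Fin.addCases (fun i => ?_) (fun i => ?_) i
      · simpa using hp i
      · simpa using hq i
    · intro i j hij
      have h1 : p i ∣ ∏ i, p i ^ 1 :=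
        (dvd_pow_self _ one_ne_zero).trans (Finset.dvd_prod_of_mem _ (Finset.mem_univ i))
      have h2 : p i ∣ ∏ j, q j ^ β j := hij ▸
        (dvd_pow_self _ (hβ j)).trans (Finset.dvd_prod_of_mem _ (Finset.mem_univ j))
      exact (hp i).one_lt.ne' (Nat.eq_one_of_dvd_coprimes hcop h1 h2)
    · simp [Fin.prod_univ_add, Finset.prod_pow]

theorem lt_factorization_of_mem_Ppi {r α m p : ℕ} {β : Fin r → ℕ} (h : ∀ i, α < β i)
    (hm : m ∈ Ppi β) (hp : p.Prime) (hpm : p ∣ m) : α < m.factorization p := by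
  have hm0 := (pos_of_mem_Ppi hm).ne'
  obtain ⟨q, hq, -, rfl⟩ := hm
  obtain ⟨i, -, hi⟩ := (hp.prime.dvd_finsetProd_iff _).1 hpm
  have hpq : p = q i := (Nat.prime_dvd_prime_iff_eq hp (hq i)).1 (hp.dvd_of_dvd_pow hi)
  refine (h i).trans_le ((hp.pow_dvd_iff_le_factorization hm0).1 ?_)
  rw [hpq]
  exact Finset.dvd_prod_of_mem (fun i => q i ^ β i) (Finset.mem_univ i)

theorem factorization_pow_mul_eq_iff_dvd {r α m s p : ℕ} {β : Fin r → ℕ} (hα : 0 < α)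
    (h : ∀ i, α < β i) (hm : m ∈ Ppi β) (hs : Squarefree s) (hcop : Nat.Coprime s m)
    (hp : p.Prime) : (s ^ α * m).factorization p = α ↔ p ∣ s := by
  have hm0 := (pos_of_mem_Ppi hm).ne'
  rw [Nat.factorization_mul (pow_ne_zero _ hs.ne_zero) hm0, Nat.factorization_pow]
  simp only [Finsupp.add_apply, Finsupp.smul_apply, smul_eq_mul]
  by_cases hps : p ∣ s
  · have hpm : ¬ p ∣ m := fun hpm => hp.one_lt.ne' (Nat.eq_one_of_dvd_coprimes hcop hps hpm)
    rw [Nat.factorization_eq_zero_of_not_dvd hpm,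
      le_antisymm (hs.natFactorization_le_one p)
        ((hp.dvd_iff_one_le_factorization hs.ne_zero).1 hps)]
    simp [hps]
  · rw [Nat.factorization_eq_zero_of_not_dvd hps]
    by_cases hpm : p ∣ m
    · have := lt_factorization_of_mem_Ppi h hm hp hpm
      simp only [hps, iff_false]
      omega
    · rw [Nat.factorization_eq_zero_of_not_dvd hpm]
      simp only [hps, iff_false]
      omega

theorem pow_mul_injective_of_mem_Ppi {r α m n s t : ℕ} {β : Fin r → ℕ} (hα : 0 < α)
    (h : ∀ i, α < β i) (hm : m ∈ Ppi β) (hn : n ∈ Ppi β) (hs : Squarefree s) (ht : Squarefree t)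
    (hsm : Nat.Coprime s m) (htn : Nat.Coprime t n) (heq : s ^ α * m = t ^ α * n) :
    m = n ∧ s = t := by
  have hst : s = t := by
    rw [← Nat.prod_primeFactors_of_squarefree hs, ← Nat.prod_primeFactors_of_squarefree ht]
    congr 1
    ext p
    rw [Nat.mem_primeFactors_of_ne_zero hs.ne_zero, Nat.mem_primeFactors_of_ne_zero ht.ne_zero]
    refine and_congr_right fun hp => ?_
    rw [← factorization_pow_mul_eq_iff_dvd hα h hm hs hsm hp, heq,
      factorization_pow_mul_eq_iff_dvd hα h hn ht htn hp]
  subst hst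
  exact ⟨Nat.eq_of_mul_eq_mul_left (pow_pos (Nat.pos_of_ne_zero hs.ne_zero) _) heq, rfl⟩

theorem countIn_Ppi_one (k : ℕ) (y : ℝ) :
    (countIn (Ppi fun _ : Fin k => 1) y : ℝ) = squarefreeAlmostPrimeCount k y := by
  have hset : {n : ℕ | (n : ℝ) ≤ y ∧ n ∈ Ppi fun _ : Fin k => 1} =
      ↑(squarefreeAlmostPrimes k ⌊y⌋₊) := by
    ext n
    rw [Finset.mem_coe, mem_squarefreeAlmostPrimes, Set.mem_ofPred_eq, mem_Ppi_one_iff]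
    refine and_congr_left fun hn => ?_
    rw [Nat.le_floor_iff' hn.1.ne_zero]
  rw [countIn, hset, squarefreeAlmostPrimeCount, Nat.card_coe_set_eq, Set.ncard_coe_finset]

/-- The number of squarefree integers in `[1, u]` with exactly `k` prime factors that are
coprime to `m`. -/
noncomputable def coprimeAlmostPrimeCount (k m : ℕ) (u : ℝ) : ℝ :=
  ((squarefreeAlmostPrimes k ⌊u⌋₊).filter fun s => Nat.Coprime s m).card

theorem coprimeAlmostPrimeCount_nonneg (k m : ℕ) (u : ℝ) : 0 ≤ coprimeAlmostPrimeCount k m u :=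
  Nat.cast_nonneg _

theorem coprimeAlmostPrimeCount_le (k m : ℕ) (u : ℝ) :
    coprimeAlmostPrimeCount k m u ≤ squarefreeAlmostPrimeCount k u :=
  Nat.cast_le.2 (Finset.card_filter_le _ _)

theorem squarefreeAlmostPrimeCount_succ_le (k : ℕ) {m : ℕ} (hm : m ≠ 0) (u : ℝ) :
    squarefreeAlmostPrimeCount (k + 1) u ≤ coprimeAlmostPrimeCount (k + 1) m u +
      m.primeFactors.card * squarefreeAlmostPrimeCount k u := by
  set N := ⌊u⌋₊ with hN
  have hsub : (squarefreeAlmostPrimes (k + 1) N).filter (fun s => ¬ Nat.Coprime s m) ⊆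
      m.primeFactors.biUnion fun p => (squarefreeAlmostPrimes (k + 1) N).filter (p ∣ ·) := by
    intro s hs
    obtain ⟨h1, h2⟩ := Finset.mem_filter.1 hs
    obtain ⟨p, hp, hps, hpm⟩ := Nat.Prime.not_coprime_iff_dvd.1 h2
    exact Finset.mem_biUnion.2 ⟨p, (Nat.mem_primeFactors_of_ne_zero hm).2 ⟨hp, hpm⟩,
      Finset.mem_filter.2 ⟨h1, hps⟩⟩
  have hle : ((squarefreeAlmostPrimes (k + 1) N).filter (fun s => ¬ Nat.Coprime s m)).card ≤
      m.primeFactors.card * (squarefreeAlmostPrimes k N).card := by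
    refine (Finset.card_le_card hsub).trans (Finset.card_biUnion_le_card_mul _ _ _ fun p hp => ?_)
    rw [card_filter_dvd_squarefreeAlmostPrimes_succ k N (Nat.prime_of_mem_primeFactors hp)]
    exact (Finset.card_filter_le _ _).trans
      (Finset.card_le_card (squarefreeAlmostPrimes_mono k (Nat.div_le_self N p)))
  have hsum := Finset.card_filter_add_card_filter_not (s := squarefreeAlmostPrimes (k + 1) N)
    (fun s => Nat.Coprime s m)
  simp only [squarefreeAlmostPrimeCount, coprimeAlmostPrimeCount]
  rw [← hN]
  norm_cast
  omega

theorem pow_mul_le_iff_le_rpow_div {s m α : ℕ} (hα : 0 < α) (hm : 0 < m) {x : ℝ} (hx : 0 ≤ x) :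
    ((s ^ α * m : ℕ) : ℝ) ≤ x ↔ (s : ℝ) ≤ x ^ ((1 : ℝ) / α) / (m : ℝ) ^ ((1 : ℝ) / α) := by
  have hm' : (0 : ℝ) < m := by exact_mod_cast hm
  have hα' : (α : ℝ) ≠ 0 := by exact_mod_cast hα.ne'
  rw [← div_rpow hx hm'.le, one_div, le_rpow_inv_iff_of_pos (by positivity) (by positivity)
    (by positivity), le_div_iff₀ hm', rpow_natCast]
  push_cast
  rfl

open Classical in
theorem countIn_Ppi_append (k : ℕ) {r α : ℕ} (hα : 0 < α) {β : Fin r → ℕ} (h : ∀ i, α < β i)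
    {x : ℝ} (hx : 0 ≤ x) :
    (countIn (Ppi (Fin.append (fun _ : Fin k => α) β)) x : ℝ) =
      ∑' m : Ppi β, coprimeAlmostPrimeCount k m
        (x ^ ((1 : ℝ) / α) / ((m : ℕ) : ℝ) ^ ((1 : ℝ) / α)) := by
  set u : ℕ → ℝ := fun m => x ^ ((1 : ℝ) / α) / (m : ℝ) ^ ((1 : ℝ) / α) with hu
  set M : Finset ℕ := (Finset.Icc 1 ⌊x⌋₊).filter (· ∈ Ppi β) with hM
  set A : ℕ → Finset ℕ :=
    fun m => (squarefreeAlmostPrimes k ⌊u m⌋₊).filter fun s => Nat.Coprime s m with hA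
  have hmemA {m s : ℕ} (hm : m ∈ Ppi β) : s ∈ A m ↔
      ((s ^ α * m : ℕ) : ℝ) ≤ x ∧ s ∈ Ppi (fun _ : Fin k => 1) ∧ Nat.Coprime s m := by
    rw [hA, Finset.mem_filter, mem_squarefreeAlmostPrimes, mem_Ppi_one_iff, and_assoc]
    refine and_congr_left fun hs => ?_
    rw [Nat.le_floor_iff' hs.1.1.ne_zero, pow_mul_le_iff_le_rpow_div hα (pos_of_mem_Ppi hm) hx]
  have hmemM {m s : ℕ} (hm : m ∈ Ppi β) (hs : s ∈ A m) : m ∈ M := by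
    obtain ⟨h1, h2, -⟩ := (hmemA hm).1 hs
    have hm0 := pos_of_mem_Ppi hm
    refine Finset.mem_filter.2 ⟨Finset.mem_Icc.2 ⟨hm0, Nat.le_floor (le_trans ?_ h1)⟩, hm⟩
    exact_mod_cast Nat.le_mul_of_pos_left m (pow_pos (pos_of_mem_Ppi h2) α)
  have hset : {n : ℕ | (n : ℝ) ≤ x ∧ n ∈ Ppi (Fin.append (fun _ : Fin k => α) β)} =
      ↑((M.sigma A).image fun q => q.2 ^ α * q.1) := by
    ext n
    simp only [Finset.coe_image, Set.mem_image, Finset.mem_coe, Finset.mem_sigma, Set.mem_ofPred_eq]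
    rw [mem_Ppi_append_iff fun i => (h i).ne_bot]
    constructor
    · rintro ⟨hn, m, hm, s, hs, hcop, rfl⟩
      have hsA := (hmemA hm).2 ⟨hn, hs, hcop⟩
      exact ⟨⟨m, s⟩, ⟨hmemM hm hsA, hsA⟩, rfl⟩
    · rintro ⟨⟨m, s⟩, ⟨hm, hs⟩, rfl⟩
      have hm' := (Finset.mem_filter.1 hm).2
      obtain ⟨h1, h2, h3⟩ := (hmemA hm').1 hs
      exact ⟨h1, m, hm', s, h2, h3, rfl⟩
  have hinj : Set.InjOn (fun q : (_ : ℕ) × ℕ => q.2 ^ α * q.1) (M.sigma A) := by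
    rintro ⟨m, s⟩ hms ⟨n, t⟩ hnt heq
    obtain ⟨hm, hs⟩ := Finset.mem_sigma.1 (Finset.mem_coe.1 hms)
    obtain ⟨hn, ht⟩ := Finset.mem_sigma.1 (Finset.mem_coe.1 hnt)
    have hm' := (Finset.mem_filter.1 hm).2
    have hn' := (Finset.mem_filter.1 hn).2
    obtain ⟨-, hs1, hs2⟩ := (hmemA hm').1 hs
    obtain ⟨-, ht1, ht2⟩ := (hmemA hn').1 ht
    obtain ⟨rfl, rfl⟩ := pow_mul_injective_of_mem_Ppi hα h hm' hn' (mem_Ppi_one_iff.1 hs1).1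
      (mem_Ppi_one_iff.1 ht1).1 hs2 ht2 heq
    rfl
  rw [countIn, hset, Nat.card_coe_set_eq, Set.ncard_coe_finset, Finset.card_image_of_injOn hinj,
    Finset.card_sigma, tsum_subtype (Ppi β) fun m => coprimeAlmostPrimeCount k m (u m),
    tsum_eq_sum (s := M), Nat.cast_sum]
  · refine Finset.sum_congr rfl fun m hm => ?_
    rw [Set.indicator_of_mem (Finset.mem_filter.1 hm).2]
    rfl
  · intro m hm
    by_cases hmP : m ∈ Ppi β
    · rw [Set.indicator_of_mem hmP]
      refine Nat.cast_eq_zero.2 (Finset.card_eq_zero.2 (Finset.eq_empty_of_forall_notMem ?_))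
      exact fun s hs => hm (hmemM hmP hs)
    · exact Set.indicator_of_notMem hmP _

theorem summable_Ppi_rpow {r : ℕ} {β : Fin r → ℕ} {δ : ℝ} (h : ∀ i, 1 < δ * β i) :
    Summable fun m : Ppi β => ((m : ℕ) : ℝ) ^ (-δ) := by
  choose g hprime _ hg using fun m : Ppi β => m.2
  have hginj : Function.Injective g := fun a b hab => Subtype.ext (by rw [hg a, hg b, hab])
  set f : Fin r → ℕ → ℝ := fun i n => (n : ℝ) ^ (-(δ * β i)) with hf
  have hf0 (i : Fin r) (n : ℕ) : 0 ≤ f i n := by positivity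
  have hfs (i : Fin r) : Summable (f i) := Real.summable_nat_rpow.2 (by linarith [h i])
  refine summable_of_sum_le (c := ∏ i, ∑' n, f i n) (fun m => by positivity) fun u => ?_
  set N := u.sup (fun m => Finset.univ.sup (g m)) + 1 with hN
  have hmem : u.image g ⊆ Fintype.piFinset fun _ : Fin r => Finset.range N := by
    intro p hp
    obtain ⟨m, hm, rfl⟩ := Finset.mem_image.1 hp
    refine Fintype.mem_piFinset.2 fun i => Finset.mem_range.2 (Nat.lt_succ_of_le ?_)
    exact (Finset.le_sup (f := g m) (Finset.mem_univ i)).trans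
      (Finset.le_sup (f := fun m => Finset.univ.sup (g m)) hm)
  calc ∑ m ∈ u, ((m : ℕ) : ℝ) ^ (-δ) = ∑ m ∈ u, ∏ i, f i (g m i) := by
        refine Finset.sum_congr rfl fun m _ => ?_
        conv_lhs => rw [hg m]
        push_cast
        rw [← Real.finsetProd_rpow _ _ fun i _ => by positivity]
        refine Finset.prod_congr rfl fun i _ => ?_
        rw [hf, ← rpow_natCast, ← rpow_mul (by positivity)]
        congr 1
        ring
    _ = ∑ p ∈ u.image g, ∏ i, f i (p i) :=
        (Finset.sum_image (f := fun p : Fin r → ℕ => ∏ i, f i (p i))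
          fun a _ b _ hab => hginj hab).symm
    _ ≤ ∑ p ∈ Fintype.piFinset fun _ : Fin r => Finset.range N, ∏ i, f i (p i) :=
        Finset.sum_le_sum_of_subset_of_nonneg hmem fun p _ _ =>
          Finset.prod_nonneg fun i _ => hf0 i _
    _ = ∏ i, ∑ n ∈ Finset.range N, f i n := (Finset.prod_univ_sum _ _).symm
    _ ≤ ∏ i, ∑' n, f i n := Finset.prod_le_prod
        (fun i _ => Finset.sum_nonneg fun n _ => hf0 i n)
        fun i _ => (hfs i).sum_le_tsum _ fun n _ => hf0 i n

theorem nonempty_Ppi {r : ℕ} (β : Fin r → ℕ) : (Ppi β).Nonempty :=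
  ⟨_, fun i => Nat.nth Nat.Prime i, fun _ => Nat.prime_nth_prime _,
    fun _ _ hab => Fin.ext (Nat.nth_injective Nat.infinite_setOfPred_prime hab), rfl⟩

open Topology in
theorem tendsto_coprimeAlmostPrimeCount_div (k : ℕ) {m : ℕ} (hm : m ≠ 0) {c : ℝ} (hc : 1 ≤ c) :
    Tendsto (fun y => coprimeAlmostPrimeCount (k + 1) m (y / c) /
      squarefreeAlmostPrimeCount (k + 1) y) atTop (𝓝 (1 / c)) := by
  obtain ⟨hRV, -, h0⟩ := squarefreeAlmostPrimeCount_asymptotics k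
  have hlow := (hRV c hc).sub (h0.const_mul (m.primeFactors.card : ℝ))
  rw [mul_zero, sub_zero] at hlow
  refine tendsto_of_tendsto_of_tendsto_of_le_of_le' hlow (hRV c hc) ?_ ?_
  · filter_upwards [eventually_ge_atTop 0] with y hy
    have h1 := squarefreeAlmostPrimeCount_succ_le k hm (y / c)
    have h2 := squarefreeAlmostPrimeCount_mono k (div_le_self hy hc)
    have h3 : (m.primeFactors.card : ℝ) * squarefreeAlmostPrimeCount k (y / c) ≤
      m.primeFactors.card * squarefreeAlmostPrimeCount k y := by gcongr
    rw [mul_div_assoc', ← sub_div]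
    exact div_le_div_of_nonneg_right (by linarith) (squarefreeAlmostPrimeCount_nonneg _ _)
  · exact Eventually.of_forall fun y => div_le_div_of_nonneg_right
      (coprimeAlmostPrimeCount_le _ _ _) (squarefreeAlmostPrimeCount_nonneg _ _)

/-- `π_α(x) ∼ π_k(x^{1/α}) ∑_{n ∈ 𝒫_β^π} n^{-1/α}` where the exponent
vector is `(α,…,α,α₁,…,α_r)` with `k ≥ 1` copies of `α` and `α < αᵢ` for all `i`. -/
theorem main_theorem_pi (k r α : ℕ) (hk : 1 ≤ k) (hα : 0 < α) (β : Fin r → ℕ)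
    (h : ∀ i, α < β i) :
    Tendsto
      (fun x : ℝ =>
        (countIn (Ppi (Fin.append (fun _ : Fin k => α) β)) x : ℝ) /
          ((countIn (Ppi (fun _ : Fin k => 1)) (x ^ ((1 : ℝ) / (α : ℝ))) : ℝ) *
            ∑' n : Ppi β, ((n : ℕ) : ℝ) ^ (-(1 : ℝ) / (α : ℝ))))
      atTop (nhds 1) := by
  obtain ⟨j, rfl⟩ := Nat.exists_eq_add_of_le' hk
  have hα' : (0 : ℝ) < α := by exact_mod_cast hα
  have hβ (i : Fin r) : (α : ℝ) + 1 ≤ β i := by exact_mod_cast h i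
  obtain ⟨hRV, ⟨B, hB⟩, -⟩ := squarefreeAlmostPrimeCount_asymptotics j
  set F := squarefreeAlmostPrimeCount (j + 1) with hF
  have hF0 := squarefreeAlmostPrimeCount_nonneg (j + 1)
  have hpos : ∀ᶠ y in atTop, 0 < F y := eventually_pos_of_primeCounting_le hF0 hB
  obtain ⟨θ, hθ0, hθ1, hθ⟩ : ∃ θ : ℝ, 0 ≤ θ ∧ θ < 1 ∧ 1 < θ / α * (α + 1) := by
    refine ⟨(2 * α + 1) / (2 * (α + 1)), by positivity, ?_, ?_⟩
    · rw [div_lt_one (by positivity)]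
      linarith
    · have : (2 * (α : ℝ) + 1) / (2 * (α + 1)) / α * (α + 1) = (2 * α + 1) / (2 * α) := by
        field_simp
      rw [this, one_lt_div (by positivity)]
      linarith
  obtain ⟨C, Y, hCY⟩ := hRV.exists_le_mul_rpow hF0 (squarefreeAlmostPrimeCount_mono _)
    (squarefreeAlmostPrimeCount_of_lt_one _) hpos hθ0 hθ1
  have hy : Tendsto (fun x : ℝ => x ^ ((1 : ℝ) / (α : ℝ))) atTop atTop :=
    tendsto_rpow_atTop (by positivity)
  have hm1 (m : Ppi β) : (1 : ℝ) ≤ ((m : ℕ) : ℝ) := by exact_mod_cast pos_of_mem_Ppi m.2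
  have hc1 (m : Ppi β) : (1 : ℝ) ≤ ((m : ℕ) : ℝ) ^ ((1 : ℝ) / (α : ℝ)) :=
    one_le_rpow (hm1 m) (by positivity)
  have hlim : Tendsto (fun x : ℝ => ∑' m : Ppi β, coprimeAlmostPrimeCount (j + 1) m
      (x ^ ((1 : ℝ) / (α : ℝ)) / ((m : ℕ) : ℝ) ^ ((1 : ℝ) / (α : ℝ))) /
        F (x ^ ((1 : ℝ) / (α : ℝ)))) atTop
      (nhds (∑' n : Ppi β, ((n : ℕ) : ℝ) ^ (-(1 : ℝ) / (α : ℝ)))) := by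
    refine tendsto_tsum_of_dominated_convergence
      (bound := fun m : Ppi β => C * ((m : ℕ) : ℝ) ^ (-(θ / α))) ?_ ?_ ?_
    · refine (summable_Ppi_rpow fun i => hθ.trans_le ?_).mul_left C
      have := hβ i
      gcongr
    · intro m
      have := (tendsto_coprimeAlmostPrimeCount_div j (pos_of_mem_Ppi m.2).ne' (hc1 m)).comp hy
      rwa [one_div (_ ^ _), ← rpow_neg (by positivity), ← neg_div] at this
    · filter_upwards [hy.eventually hpos, hy.eventually_ge_atTop Y] with x hx1 hx2 m
      rw [norm_of_nonneg (div_nonneg (coprimeAlmostPrimeCount_nonneg _ _ _) hx1.le),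
        div_le_iff₀ hx1]
      refine (coprimeAlmostPrimeCount_le _ _ _).trans ((hCY _ hx2 _ (hc1 m)).trans_eq ?_)
      rw [← rpow_mul (by positivity)]
      congr 3
      ring
  have hsum : Summable fun n : Ppi β => ((n : ℕ) : ℝ) ^ (-(1 : ℝ) / (α : ℝ)) := by
    simp_rw [neg_div]
    refine summable_Ppi_rpow fun i => ?_
    rw [one_div_mul_eq_div, one_lt_div hα']
    linarith [hβ i]
  have hSpos : 0 < ∑' n : Ppi β, ((n : ℕ) : ℝ) ^ (-(1 : ℝ) / (α : ℝ)) := by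
    obtain ⟨m, hm⟩ := nonempty_Ppi β
    exact hsum.tsum_pos (fun n => by positivity) ⟨m, hm⟩
      (rpow_pos_of_pos (one_pos.trans_le (hm1 ⟨m, hm⟩)) _)
  have hdiv := hlim.div_const (∑' n : Ppi β, ((n : ℕ) : ℝ) ^ (-(1 : ℝ) / (α : ℝ)))
  rw [div_self hSpos.ne'] at hdiv
  refine hdiv.congr' ?_
  filter_upwards [eventually_ge_atTop 0] with x hx
  rw [countIn_Ppi_append _ hα h hx, countIn_Ppi_one, tsum_div_const, div_div]
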